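/- Let 1 ≤ n' < n, let p : (Fin n' → Ω) → ℝ with 0 ≤ p ≤ 1 be a (possibly probabilistic) memory-n' strategy of player 2, and let Q : {C,D} × (Fin n → Ω) → ℝ satisfy the player-1 memory-n Bellman optimality equation against p. Then Q depends only on the n' most recent states: for every action σ and all histories h, h' : Fin n → Ω with h i = h' i for every i < n', one has Q(σ,h) = Q(σ,h'). Moreover, the induced function Q' : {C,D} × (Fin n' → Ω) → ℝ, defined by Q'(σ,g) = Q(σ,h) for any h with h i = g i for all i < n', satisfies the player-1 memory-n' Bellman optimality equation against p; consequently the optimal (greedy) strategy obtained from memory-n learning coincides with the one obtained from memory-n' learning: Q(C,h) > Q(D,h) if and only if Q'(C, h↾n') > Q'(D, h↾n'). -/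

import Mathlib

inductive Act where
  | C : Act
  | D : Act
deriving DecidableEq

open Act

abbrev St : Type := Act × Act

/-- Player 1's payoff in the prisoner's dilemma. -/
def r1 (R S T P : ℝ) : Act → Act → ℝ
  | C, C => R
  | C, D => S
  | D, C => T
  | D, D => P

/-- Prepend the new state `(σ, σ2)` to a memory-`n` history, discarding the oldest state. -/
def push {n : ℕ} (σ σ2 : Act) (h : Fin n → St) : Fin n → St := fun i =>
  if (i : ℕ) = 0 then (σ, σ2)
  else h ⟨(i : ℕ) - 1, Nat.lt_of_le_of_lt (Nat.sub_le _ _) i.isLt⟩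

/-- Restrict a memory-`n` history to its `n'` most recent states (`n' ≤ n`). -/
def restrict {n n' : ℕ} (hle : n' ≤ n) (h : Fin n → St) : Fin n' → St := fun i =>
  h ⟨(i : ℕ), Nat.lt_of_lt_of_le i.isLt hle⟩

theorem push_eq_push_of_agree {n m : ℕ} (σ σ2 : Act) {h h' : Fin n → St}
    (hh : ∀ i : Fin n, (i : ℕ) < m → h i = h' i) (i : Fin n) (hi : (i : ℕ) < m + 1) :
    push σ σ2 h i = push σ σ2 h' i := by
  unfold push
  split_ifs with h0
  · rfl
  · exact hh _ (by simp only; omega)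

theorem restrict_push {n n' : ℕ} (hle : n' ≤ n) (σ σ2 : Act) (h : Fin n → St) :
    restrict hle (push σ σ2 h) = push σ σ2 (restrict hle h) :=
  rfl

theorem restrict_eq_of_agree {n n' m : ℕ} (hle : n' ≤ n) (hm : n' ≤ m) {h h' : Fin n → St}
    (hh : ∀ i : Fin n, (i : ℕ) < m → h i = h' i) : restrict hle h = restrict hle h' :=
  funext fun i => hh _ (i.isLt.trans_le hm)

theorem restrict_surjective {n n' : ℕ} (hle : n' ≤ n) :
    Function.Surjective (restrict hle) := fun g =>
  ⟨fun i => if hi : (i : ℕ) < n' then g ⟨i, hi⟩ else (C, C), by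
    funext i
    simp [restrict]⟩

/-- A function of the history whose value is determined by the `n'` most recent states and by its
own values at the pushed histories depends only on those `n'` states: after at most `n` pushes, two
histories agreeing there have become equal. -/
theorem eq_of_agree_of_push {n n' : ℕ} (Q : Act → (Fin n → St) → ℝ) (hle : n' ≤ n)
    (hQ : ∀ σ (h h' : Fin n → St), restrict hle h = restrict hle h' →
      (∀ τ σ1 σ2, Q τ (push σ1 σ2 h) = Q τ (push σ1 σ2 h')) → Q σ h = Q σ h')
    (k m : ℕ) (hk : n ≤ m + k) (hm : n' ≤ m) (σ : Act) (h h' : Fin n → St)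
    (hh : ∀ i : Fin n, (i : ℕ) < m → h i = h' i) : Q σ h = Q σ h' := by
  induction k generalizing m σ h h' with
  | zero =>
    have : h = h' := funext fun i => hh i (i.isLt.trans_le hk)
    rw [this]
  | succ k ih =>
    exact hQ σ h h' (restrict_eq_of_agree hle hm hh) fun τ σ1 σ2 =>
      ih (m + 1) (by omega) (by omega) τ _ _ (push_eq_push_of_agree σ1 σ2 hh)

/-- a solution of the player-1 memory-`n` Bellman optimality equation against a
memory-`n'` strategy of player 2 (with `n' < n`) depends only on the `n'` most recent states;
the induced memory-`n'` function satisfies the memory-`n'` Bellman optimality equation, and the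
greedy strategies at the two memory lengths coincide. -/
theorem stmt_12 (R S T P γ : ℝ) (hTR : T > R) (hRP : R > P) (hPS : P > S)
    (h2R : 2 * R > T + S) (hγ0 : 0 ≤ γ) (hγ1 : γ < 1)
    (n' n : ℕ) (hn' : 1 ≤ n') (hnn : n' < n)
    (p : (Fin n' → St) → ℝ) (hp0 : ∀ g, 0 ≤ p g) (hp1 : ∀ g, p g ≤ 1)
    (Q : Act → (Fin n → St) → ℝ)
    (hQ : ∀ σ (h : Fin n → St), Q σ h =
      p (restrict hnn.le h) *
        (r1 R S T P σ C + γ * max (Q C (push σ C h)) (Q D (push σ C h))) +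
      (1 - p (restrict hnn.le h)) *
        (r1 R S T P σ D + γ * max (Q C (push σ D h)) (Q D (push σ D h)))) :
    (∀ (σ : Act) (h h' : Fin n → St),
      (∀ i : Fin n, (i : ℕ) < n' → h i = h' i) → Q σ h = Q σ h') ∧
    (∀ Q' : Act → (Fin n' → St) → ℝ,
      (∀ (σ : Act) (h : Fin n → St), Q' σ (restrict hnn.le h) = Q σ h) →
      ((∀ (σ : Act) (g : Fin n' → St), Q' σ g =
          p g * (r1 R S T P σ C + γ * max (Q' C (push σ C g)) (Q' D (push σ C g))) +
          (1 - p g) *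
            (r1 R S T P σ D + γ * max (Q' C (push σ D g)) (Q' D (push σ D g)))) ∧
        (∀ h : Fin n → St,
          Q C h > Q D h ↔ Q' C (restrict hnn.le h) > Q' D (restrict hnn.le h)))) := by
  refine ⟨fun σ h h' hh => ?_, fun Q' hQ' => ⟨fun σ g => ?_, fun h => ?_⟩⟩
  · refine eq_of_agree_of_push Q hnn.le (fun σ h h' hr hp => ?_) n n' (by omega) le_rfl σ h h' hh
    rw [hQ σ h, hQ σ h', hr]
    simp only [hp]
  · obtain ⟨h, rfl⟩ := restrict_surjective hnn.le g
    simp only [← restrict_push, hQ']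
    exact hQ σ h
  · simp only [hQ']
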